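/- Let d ≥ 1, c > 0, and let D : ℝ^{d×d} × ℝ^{d×d} → [0,∞) satisfy D(Id,Id) = 0, D(F,Id) ≥ c·dist(F, SO(d)) for all F in a neighborhood of Id, and suppose D² is twice differentiable at (Id,Id). Then there exists a constant c' > 0 such that ∂²_{F₁²}D²(Id,Id)[F,F] ≥ c'·|sym(F)|² for all F ∈ ℝ^{d×d}, where ∂²_{F₁²}D²(Id,Id) denotes the second derivative at Id of the partial map G ↦ D²(G,Id), sym(F) := (F + Fᵀ)/2, and |·| is the Frobenius norm. In particular, the tensor of viscosity coefficients ℂ_D := ½·∂²_{F₁²}D²(Id,Id) satisfies ℂ_D[F,F] ≥ (c'/2)|sym(F)|². -/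

import Mathlib

open Matrix Filter Topology

attribute [local instance] Matrix.frobeniusNormedAddCommGroup Matrix.frobeniusNormedSpace

/-- Second-order Taylor expansion along a ray, at a critical zero of a function that is merely
twice differentiable at the base point. -/
theorem tendsto_div_sq_of_differentiableAt_fderiv {E : Type*} [NormedAddCommGroup E]
    [NormedSpace ℝ E] {g : E → ℝ} {x : E} (hg0 : g x = 0) (hg1 : fderiv ℝ g x = 0)
    (hdiff : ∀ᶠ y in 𝓝 x, DifferentiableAt ℝ g y) (hdiff2 : DifferentiableAt ℝ (fderiv ℝ g) x)
    (v : E) :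
    Tendsto (fun t : ℝ => g (x + t • v) / t ^ 2) (𝓝[>] 0)
      (𝓝 (fderiv ℝ (fderiv ℝ g) x v v / 2)) := by
  have hline (t : ℝ) : HasDerivAt (fun t : ℝ => x + t • v) v t := by
    simpa using ((hasDerivAt_id t).smul_const v).const_add x
  have hlim : Tendsto (fun t : ℝ => x + t • v) (𝓝 0) (𝓝 x) := by
    simpa using (hline 0).continuousAt.tendsto
  have hd : ∀ᶠ t : ℝ in 𝓝 0,
      HasDerivAt (fun t : ℝ => g (x + t • v)) (fderiv ℝ g (x + t • v) v) t := by
    filter_upwards [hlim.eventually hdiff] with t ht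
    exact ht.hasFDerivAt.comp_hasDerivAt t (hline t)
  have h2 : HasDerivAt (fun t : ℝ => fderiv ℝ g (x + t • v) v)
      (fderiv ℝ (fderiv ℝ g) x v v) 0 := by
    have hx : HasFDerivAt (fderiv ℝ g) (fderiv ℝ (fderiv ℝ g) x) (x + (0 : ℝ) • v) := by
      simpa using hdiff2.hasFDerivAt
    have h : HasDerivAt (fun t : ℝ => fderiv ℝ g (x + t • v)) (fderiv ℝ (fderiv ℝ g) x v) 0 :=
      hx.comp_hasDerivAt (0 : ℝ) (hline 0)
    exact (ContinuousLinearMap.apply ℝ ℝ v).hasFDerivAt.comp_hasDerivAt (0 : ℝ) h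
  have hslope : Tendsto (fun t : ℝ => fderiv ℝ g (x + t • v) v / (2 * t)) (𝓝[>] 0)
      (𝓝 (fderiv ℝ (fderiv ℝ g) x v v / 2)) := by
    have h := (hasDerivAt_iff_tendsto_slope_zero.1 h2).mono_left
      (nhdsWithin_mono (0 : ℝ) fun t (ht : 0 < t) => ht.ne')
    refine (h.div_const 2).congr fun t => ?_
    simp only [zero_add, zero_smul, add_zero, hg1, _root_.zero_apply, sub_zero,
      smul_eq_mul]
    rw [div_mul_eq_div_div_swap, inv_mul_eq_div, div_right_comm]
  refine HasDerivAt.lhopital_zero_nhdsGT (hd.filter_mono nhdsWithin_le_nhds)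
    (Eventually.of_forall fun t => by simpa using hasDerivAt_pow 2 t) ?_ ?_ ?_ hslope
  · filter_upwards [self_mem_nhdsWithin] with t (ht : 0 < t)
    positivity
  · have h := hd.self_of_nhds.continuousAt.tendsto
    simp only [zero_smul, add_zero, hg0] at h
    exact h.mono_left nhdsWithin_le_nhds
  · have h : ContinuousAt (fun t : ℝ => t ^ 2) 0 := by fun_prop
    simpa [ContinuousAt] using h.tendsto.mono_left nhdsWithin_le_nhds

theorem Matrix.frobenius_norm_sq_eq_trace {m n : Type*} [Fintype m] [Fintype n]
    (A : Matrix m n ℝ) : ‖A‖ ^ 2 = (Aᵀ * A).trace := by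
  rw [Matrix.frobenius_norm_def, ← Real.sqrt_eq_rpow, Real.sq_sqrt (by positivity),
    Finset.sum_comm]
  simp [Matrix.trace, Matrix.mul_apply, sq]

theorem Matrix.frobenius_norm_eq_of_transpose_mul_self {n : Type*} [Fintype n] [DecidableEq n]
    {Q : Matrix n n ℝ} (hQ : Qᵀ * Q = 1) : ‖Q‖ = ‖(1 : Matrix n n ℝ)‖ := by
  rw [← sq_eq_sq₀ (norm_nonneg _) (norm_nonneg _), Matrix.frobenius_norm_sq_eq_trace,
    Matrix.frobenius_norm_sq_eq_trace, hQ]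
  simp

theorem Matrix.frobenius_norm_transpose_mul_self_sub_one_le {n : Type*} [Fintype n]
    [DecidableEq n] (G : Matrix n n ℝ) {Q : Matrix n n ℝ} (hQ : Qᵀ * Q = 1) :
    ‖Gᵀ * G - 1‖ ≤ ‖G - Q‖ * (‖G‖ + ‖(1 : Matrix n n ℝ)‖) := by
  have h : Gᵀ * G - 1 = (G - Q)ᵀ * G + Qᵀ * (G - Q) := by
    rw [← hQ, transpose_sub]
    noncomm_ring
  calc ‖Gᵀ * G - 1‖ ≤ ‖(G - Q)ᵀ * G‖ + ‖Qᵀ * (G - Q)‖ := h ▸ norm_add_le _ _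
    _ ≤ ‖(G - Q)ᵀ‖ * ‖G‖ + ‖Qᵀ‖ * ‖G - Q‖ :=
      add_le_add (Matrix.frobenius_norm_mul _ _) (Matrix.frobenius_norm_mul _ _)
    _ = ‖G - Q‖ * (‖G‖ + ‖(1 : Matrix n n ℝ)‖) := by
      rw [Matrix.frobenius_norm_transpose, Matrix.frobenius_norm_transpose,
        Matrix.frobenius_norm_eq_of_transpose_mul_self hQ]
      ring

theorem Matrix.frobenius_norm_div_le_infDist_specialOrthogonal {n : Type*} [Fintype n]
    [DecidableEq n] (G : Matrix n n ℝ) :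
    ‖Gᵀ * G - 1‖ / (‖G‖ + ‖(1 : Matrix n n ℝ)‖) ≤
      Metric.infDist G {Q : Matrix n n ℝ | Qᵀ * Q = 1 ∧ Q.det = 1} := by
  refine (Metric.le_infDist ⟨1, by simp⟩).2 fun Q hQ => ?_
  rw [dist_eq_norm]
  exact div_le_of_le_mul₀ (by positivity) (norm_nonneg _)
    (Matrix.frobenius_norm_transpose_mul_self_sub_one_le G hQ.1)

/-- If the dissipation distance satisfies `D(Id,Id) = 0`,
`D(F,Id) ≥ c·dist(F,SO(d))` near the identity, and `G ↦ D²(G,Id)` is twice differentiable at the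
identity, then `∂²_{F₁²}D²(Id,Id)` is coercive on symmetric matrices; in particular the tensor of
viscosity coefficients `ℂ_D = ½∂²_{F₁²}D²(Id,Id)` satisfies `ℂ_D[F,F] ≥ (c'/2)·|sym F|²`. -/
theorem viscosity_tensor_coercive
    (d : ℕ) (hd : 1 ≤ d) (c : ℝ) (hc : 0 < c)
    (D : Matrix (Fin d) (Fin d) ℝ → Matrix (Fin d) (Fin d) ℝ → ℝ)
    (hDnonneg : ∀ F₁ F₂, 0 ≤ D F₁ F₂)
    (hD11 : D 1 1 = 0)
    (hDlb : ∀ᶠ F in 𝓝 (1 : Matrix (Fin d) (Fin d) ℝ),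
      c * Metric.infDist F {Q : Matrix (Fin d) (Fin d) ℝ | Qᵀ * Q = 1 ∧ Q.det = 1} ≤ D F 1)
    (g : Matrix (Fin d) (Fin d) ℝ → ℝ)
    (hg : g = fun G => (D G 1) ^ 2)
    (hdiff : ∀ᶠ F in 𝓝 (1 : Matrix (Fin d) (Fin d) ℝ), DifferentiableAt ℝ g F)
    (hdiff2 : DifferentiableAt ℝ (fderiv ℝ g) (1 : Matrix (Fin d) (Fin d) ℝ)) :
    ∃ c' > (0 : ℝ), ∀ F : Matrix (Fin d) (Fin d) ℝ,
      c' * ‖(1 / 2 : ℝ) • (F + Fᵀ)‖ ^ 2 ≤ fderiv ℝ (fderiv ℝ g) 1 F F ∧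
      c' / 2 * ‖(1 / 2 : ℝ) • (F + Fᵀ)‖ ^ 2 ≤ (1 / 2 : ℝ) * fderiv ℝ (fderiv ℝ g) 1 F F := by
  set N := ‖(1 : Matrix (Fin d) (Fin d) ℝ)‖ with hN
  have hNpos : 0 < N := by
    have : NeZero d := ⟨by omega⟩
    exact norm_pos_iff.2 one_ne_zero
  have hg0 : g 1 = 0 := by simp [hg, hD11]
  have hg1 : fderiv ℝ g 1 = 0 := by
    refine IsLocalMin.fderiv_eq_zero (Eventually.of_forall fun G => ?_)
    rw [hg0, hg]
    positivity
  have hcoercive (F : Matrix (Fin d) (Fin d) ℝ) :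
      2 * c ^ 2 / N ^ 2 * ‖(1 / 2 : ℝ) • (F + Fᵀ)‖ ^ 2 ≤ fderiv ℝ (fderiv ℝ g) 1 F F := by
    have hline : Tendsto (fun t : ℝ => 1 + t • F) (𝓝[>] 0) (𝓝 1) := by
      have h : Continuous fun t : ℝ => 1 + t • F := by fun_prop
      simpa using (h.tendsto 0).mono_left nhdsWithin_le_nhds
    have hlower : Tendsto
        (fun t : ℝ => (c * (‖F + Fᵀ + t • (Fᵀ * F)‖ / (‖1 + t • F‖ + N))) ^ 2) (𝓝[>] 0)
        (𝓝 ((c * (‖F + Fᵀ‖ / (N + N))) ^ 2)) := by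
      have hnum : Tendsto (fun t : ℝ => F + Fᵀ + t • (Fᵀ * F)) (𝓝[>] 0) (𝓝 (F + Fᵀ)) := by
        have h : Continuous fun t : ℝ => F + Fᵀ + t • (Fᵀ * F) := by fun_prop
        simpa using (h.tendsto 0).mono_left nhdsWithin_le_nhds
      exact ((hnum.norm.div (hline.norm.add_const N) (by positivity)).const_mul c).pow 2
    have hle := le_of_tendsto_of_tendsto hlower
      (tendsto_div_sq_of_differentiableAt_fderiv hg0 hg1 hdiff hdiff2 F) (by
        filter_upwards [hline.eventually hDlb, self_mem_nhdsWithin] with t ht (htpos : 0 < t)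
        have hexp : (1 + t • F)ᵀ * (1 + t • F) - 1 = t • (F + Fᵀ + t • (Fᵀ * F)) := by
          simp only [transpose_add, transpose_one, transpose_smul, add_mul, mul_add, one_mul,
            mul_one, smul_mul_assoc, mul_smul_comm, smul_add]
          abel
        have hdist := Matrix.frobenius_norm_div_le_infDist_specialOrthogonal (1 + t • F)
        rw [hexp, norm_smul, Real.norm_of_nonneg htpos.le, mul_div_assoc] at hdist
        rw [le_div_iff₀ (by positivity), ← mul_pow, hg]
        refine pow_le_pow_left₀ (by positivity) ?_ 2
        calc _ = c * (t * (‖F + Fᵀ + t • (Fᵀ * F)‖ / (‖1 + t • F‖ + N))) := by ring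
          _ ≤ _ := mul_le_mul_of_nonneg_left hdist hc.le
          _ ≤ D (1 + t • F) 1 := ht)
    rw [norm_smul, Real.norm_of_nonneg (by norm_num : (0 : ℝ) ≤ 1 / 2)]
    have heq : 2 * c ^ 2 / N ^ 2 * (1 / 2 * ‖F + Fᵀ‖) ^ 2 =
        2 * (c * (‖F + Fᵀ‖ / (N + N))) ^ 2 := by
      field_simp
      ring
    rw [heq]
    exact (le_div_iff₀' two_pos).1 hle
  refine ⟨2 * c ^ 2 / N ^ 2, by positivity, fun F => ⟨hcoercive F, ?_⟩⟩
  linarith [hcoercive F]
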